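/- arXiv:1409.8235 — 2 statements merged into one kernel-verified Lean document; each statement's English description precedes it below -/
import Mathlib

section
/- Let a_n = ZFib[n] / log_φ(n) for n ≥ 2, where φ is the golden ratio and ZFib[n] is the Zimin type of the length-n prefix of the infinite Fibonacci word. Then liminf_{n→∞} a_n = 1/3. In particular, the sequence (a_n) has no limit. -/
open List Filter

/-- The Zimin pattern `Z_k` as a word over variables `0, 1, ..., k-1`
(`Z_0` is empty, `Z_{k+1} = Z_k · x_{k+1} · Z_k`). -/
def ziminWord : ℕ → List ℕ
  | 0 => []
  | k + 1 => ziminWord k ++ k :: ziminWord k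

/-- `w` is the image of the Zimin pattern `Z_k` under a non-erasing morphism. -/
def IsZiminImage {α : Type*} (k : ℕ) (w : List α) : Prop :=
  ∃ h : ℕ → List α, (∀ i, h i ≠ []) ∧ w = (ziminWord k).flatMap h

/-- The Zimin type of `w`: the maximum `k` such that `w` is an image of `Z_k`
under a non-erasing morphism (0 for the empty word). -/
noncomputable def ziminType {α : Type*} (w : List α) : ℕ :=
  sSup {k | IsZiminImage k w}

/-- The Zimin pattern `Z_k` embeds in `w`: some factor of `w` is an image of `Z_k`. -/
def ziminEmbeds {α : Type*} (k : ℕ) (w : List α) : Prop :=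
  ∃ u : List α, u <:+: w ∧ IsZiminImage k u

/-- Length of the longest border (proper prefix that is also a proper suffix) of `w`. -/
noncomputable def bordLen {α : Type*} (w : List α) : ℕ :=
  sSup {j | w.take j <:+ w ∧ j < w.length}

/-- Length of the longest short border (border of length `< |w|/2`) of `w`. -/
noncomputable def shortBordLen {α : Type*} (w : List α) : ℕ :=
  sSup {j | w.take j <:+ w ∧ 2 * j < w.length}

/-- The longest border of `w`. -/
noncomputable def bord {α : Type*} (w : List α) : List α := w.take (bordLen w)

/-- The longest short border of `w`. -/
noncomputable def shortBord {α : Type*} (w : List α) : List α := w.take (shortBordLen w)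

/-- The Fibonacci words over `Bool` (`a = false`, `b = true`), with
`fibWord 0 = F_0 = a`, `fibWord 1 = F_1 = F_0 F_{-1} = ab`, `F_{n} = F_{n-1} F_{n-2}`. -/
def fibWord : ℕ → List Bool
  | 0 => [false]
  | 1 => [false, true]
  | n + 2 => fibWord (n + 1) ++ fibWord n

/-- The Fibonacci numbers `Φ_n = |F_n|` (`Φ_0 = 1, Φ_1 = 2, Φ_2 = 3, ...`). -/
def Phi (n : ℕ) : ℕ := (fibWord n).length

/-- The infinite Fibonacci word `F_∞` (0-indexed letters). -/
def fibInf (i : ℕ) : Bool := (fibWord (i + 2)).getD i false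

/-- The prefix `F_∞[1..n]` of the infinite Fibonacci word. -/
def fibPrefix (n : ℕ) : List Bool := (List.range n).map fibInf


/-- The golden ratio `φ = (1 + √5)/2`. -/
noncomputable def goldenR : ℝ := (1 + Real.sqrt 5) / 2

/-- The sequence `a_n = ZFib[n] / log_φ n`, where `ZFib[n]` is the Zimin type of
the length-`n` prefix of the infinite Fibonacci word. -/
noncomputable def aseq (n : ℕ) : ℝ :=
  (ziminType (fibPrefix n) : ℝ) / (Real.log n / Real.log goldenR)
section helpers

lemma Phi_eq (n : ℕ) : Phi n = Nat.fib (n + 2) := by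
  induction n using Nat.strong_induction_on with
  | _ n ih =>
    match n with
    | 0 => rfl
    | 1 => rfl
    | n + 2 =>
      have h1 := ih (n + 1) (by omega)
      have h2 := ih n (by omega)
      have : Phi (n + 2) = Phi (n + 1) + Phi n := by simp [Phi, fibWord]
      rw [this, h1, h2, Nat.fib_add_two (n := n + 2)]
      ring

lemma fibWord_prefix_succ (n : ℕ) : fibWord n <+: fibWord (n + 1) := by
  match n with
  | 0 => exact ⟨[true], rfl⟩
  | n + 1 => exact ⟨fibWord n, rfl⟩

lemma fibWord_prefix {m n : ℕ} (h : m ≤ n) : fibWord m <+: fibWord n := by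
  induction n, h using Nat.le_induction with
  | base => exact List.prefix_refl _
  | succ n _ ih => exact ih.trans (fibWord_prefix_succ n)

lemma getD_prefix {u v : List Bool} (h : u <+: v) {i : ℕ} (hi : i < u.length) :
    v.getD i false = u.getD i false := by
  obtain ⟨t, rfl⟩ := h
  simp [List.getD, List.getElem?_append_left hi]

lemma lt_Phi (i : ℕ) : i < Phi (i + 2) := by
  rw [Phi_eq]
  induction i with
  | zero => decide
  | succ i ih =>
    have h : Nat.fib (i + 5) = Nat.fib (i + 3) + Nat.fib (i + 4) := Nat.fib_add_two
    have : 0 < Nat.fib (i + 3) := Nat.fib_pos.2 (by omega)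
    have e : i + 1 + 2 + 2 = i + 5 := by ring
    have e' : i + 2 + 2 = i + 4 := by ring
    rw [e, h]
    rw [e'] at ih
    omega

lemma fibInf_eq {n i : ℕ} (hi : i < Phi n) : fibInf i = (fibWord n).getD i false := by
  unfold fibInf
  rcases le_total n (i + 2) with h | h
  · exact getD_prefix (fibWord_prefix h) hi
  · exact (getD_prefix (fibWord_prefix h) (lt_Phi i)).symm

/-- Basic self-similarity, `g = Nat.fib` indexing. -/
lemma fibInf_S {n i : ℕ} (hi : i < Nat.fib (n + 2)) :
    fibInf (i + Nat.fib (n + 3)) = fibInf i := by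
  have e : Nat.fib (n + 4) = Nat.fib (n + 2) + Nat.fib (n + 3) := Nat.fib_add_two
  have h1 : i + Nat.fib (n + 3) < Phi (n + 2) := by
    rw [Phi_eq]
    change _ < Nat.fib (n + 4)
    omega
  have h2 : i < Phi n := by rw [Phi_eq]; exact hi
  rw [fibInf_eq h1, fibInf_eq h2]
  have hl : (fibWord (n + 1)).length = Nat.fib (n + 3) := Phi_eq (n + 1)
  simp [List.getD, fibWord, List.getElem?_append_right, hl]

lemma fib_rec (n : ℕ) : Nat.fib (n + 2) = Nat.fib n + Nat.fib (n + 1) := Nat.fib_add_two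

lemma fibInf_per (m i : ℕ) (hi : i + 2 < Nat.fib (m + 3)) :
    fibInf (i + Nat.fib (m + 2)) = fibInf i := by
  induction m generalizing i with
  | zero => simp [Nat.fib] at hi
  | succ m ih =>
    by_cases h : i < Nat.fib (m + 2)
    · exact fibInf_S h
    · obtain ⟨t, rfl⟩ := Nat.exists_eq_add_of_le (not_lt.1 h)
      have e := fib_rec (m + 2)
      have e2 := fib_rec (m + 1)
      simp only [Nat.add_assoc, Nat.reduceAdd] at e e2 hi ⊢
      have h1 : fibInf (t + Nat.fib (m + 2)) = fibInf t := ih t (by omega)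
      have h2 : fibInf (t + Nat.fib (m + 4)) = fibInf t := fibInf_S (n := m + 1) (by
        change t < Nat.fib (m + 3); omega)
      have a1 : Nat.fib (m + 2) + (t + Nat.fib (m + 3)) = t + Nat.fib (m + 4) := by omega
      rw [a1, h2, Nat.add_comm, h1]

lemma fib_ge_two (n : ℕ) : 2 ≤ Nat.fib (n + 3) :=
  (show 2 ≤ Nat.fib 3 by decide).trans (Nat.fib_mono (by omega))

lemma fibInf_alt (n : ℕ) :
    fibInf (Nat.fib (n + 3) - 2) ≠ fibInf (Nat.fib (n + 4) - 2) := by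
  have h0 : ∀ n, fibInf (Nat.fib (n + 5) - 2) = fibInf (Nat.fib (n + 3) - 2) := by
    intro n
    have e := fib_rec (n + 3)
    simp only [Nat.add_assoc, Nat.reduceAdd] at e
    have := fib_ge_two n
    have h := fibInf_S (n := n + 1) (i := Nat.fib (n + 3) - 2) (by
      change _ < Nat.fib (n + 3); omega)
    rw [← h]
    congr 1
    change _ = _ + Nat.fib (n + 4)
    omega
  induction n with
  | zero => decide
  | succ n ih =>
    intro h
    apply ih
    have := h0 n
    exact (h.trans this).symm

/-- Fine non-periodicity. -/
lemma mismatch (n r : ℕ) (h0 : 0 < r) (hr : r < Nat.fib (n + 2)) :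
    ∃ i, i + r + 2 ≤ Nat.fib (n + 3) ∧ fibInf i ≠ fibInf (i + r) := by
  induction n using Nat.strong_induction_on generalizing r with
  | _ n ih =>
    match n with
    | 0 => simp [Nat.fib] at hr; omega
    | n + 1 =>
      have e := fib_rec (n + 2)
      have e2 := fib_rec (n + 1)
      simp only [Nat.add_assoc, Nat.reduceAdd] at e e2 hr ⊢
      have g := fib_ge_two n
      rcases lt_trichotomy r (Nat.fib (n + 2)) with h | h | h
      · obtain ⟨i, h1, h2⟩ := ih n (by omega) r h0 h
        exact ⟨i, by omega, h2⟩
      · refine ⟨Nat.fib (n + 3) - 2, by omega, ?_⟩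
        have := fibInf_alt n
        have e3 : Nat.fib (n + 3) - 2 + r = Nat.fib (n + 4) - 2 := by omega
        rwa [e3]
      · match n with
        | 0 => simp [Nat.fib] at hr h; omega
        | n + 1 =>
          have e4 := fib_rec (n + 2)
          simp only [Nat.add_assoc, Nat.reduceAdd] at e e2 e4 hr h g ⊢
          obtain ⟨s, rfl⟩ := Nat.exists_eq_add_of_lt h
          obtain ⟨i, h1, h2⟩ := ih n (by omega) (s + 1) (by omega) (by omega)
          have h3 : fibInf (i + (s + 1) + Nat.fib (n + 3)) = fibInf (i + (s + 1)) :=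
            fibInf_per (n + 1) _ (by change _ < Nat.fib (n + 4); have := fib_ge_two n; have : 0 < Nat.fib (n+2) := Nat.fib_pos.2 (by omega); omega)
          refine ⟨i, by omega, ?_⟩
          rw [show i + (Nat.fib (n + 3) + s + 1) = i + (s + 1) + Nat.fib (n + 3) by omega, h3]
          exact h2

/-- Same but for `r` between consecutive Fibonacci numbers. -/
lemma mismatch' (n r : ℕ) (h0 : Nat.fib (n + 3) < r) (hr : r < Nat.fib (n + 4)) :
    ∃ i, i + r + 2 ≤ 2 * Nat.fib (n + 3) ∧ fibInf i ≠ fibInf (i + r) := by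
  have e4 := fib_rec (n + 2)
  have e5 := fib_rec (n + 1)
  simp only [Nat.add_assoc, Nat.reduceAdd] at e4 e5
  obtain ⟨s, rfl⟩ := Nat.exists_eq_add_of_lt h0
  obtain ⟨i, h1, h2⟩ := mismatch n (s + 1) (by omega) (by omega)
  have : 0 < Nat.fib (n+2) := Nat.fib_pos.2 (by omega)
  have h3 : fibInf (i + (s + 1) + Nat.fib (n + 3)) = fibInf (i + (s + 1)) :=
    fibInf_per (n + 1) _ (by change _ < Nat.fib (n + 4); omega)
  refine ⟨i, by omega, ?_⟩
  rw [show i + (Nat.fib (n + 3) + s + 1) = i + (s + 1) + Nat.fib (n + 3) by omega, h3]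
  exact h2

lemma ziminWord_lt (k x : ℕ) (hx : x ∈ ziminWord k) : x < k := by
  induction k with
  | zero => simp [ziminWord] at hx
  | succ k ih =>
    simp only [ziminWord, List.mem_append, List.mem_cons] at hx
    rcases hx with h | h | h
    · have := ih h; omega
    · omega
    · have := ih h; omega

lemma isZiminImage_succ {α : Type*} (k : ℕ) (w : List α) :
    IsZiminImage (k + 1) w ↔
      ∃ u x, IsZiminImage k u ∧ x ≠ [] ∧ w = u ++ (x ++ u) := by
  constructor
  · rintro ⟨h, hh, rfl⟩
    exact ⟨(ziminWord k).flatMap h, h k, ⟨h, hh, rfl⟩, hh k, by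
      simp [ziminWord, List.flatMap_append, List.flatMap_cons]⟩
  · rintro ⟨u, x, ⟨h, hh, rfl⟩, hx, rfl⟩
    refine ⟨fun i => if i = k then x else h i, ?_, ?_⟩
    · intro i
      by_cases hi : i = k <;> simp [hi, hx, hh]
    · have : (ziminWord k).flatMap (fun i => if i = k then x else h i)
          = (ziminWord k).flatMap h := by
        apply List.flatMap_congr
        intro a ha
        have := ziminWord_lt k a ha
        simp [this.ne]
      simp [ziminWord, List.flatMap_append, List.flatMap_cons, this]

lemma isZiminImage_zero (w : List Bool) : IsZiminImage 0 w ↔ w = [] := by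
  constructor
  · rintro ⟨h, hh, rfl⟩; rfl
  · rintro rfl
    exact ⟨fun _ => [true], by simp, rfl⟩

lemma fibPrefix_length (n : ℕ) : (fibPrefix n).length = n := by simp [fibPrefix]

lemma fibPrefix_getElem? {n i : ℕ} (h : i < n) : (fibPrefix n)[i]? = some (fibInf i) := by
  simp [fibPrefix, h]

lemma T_zero (n : ℕ) : IsZiminImage 0 (fibPrefix n) ↔ n = 0 := by
  rw [isZiminImage_zero, ← List.length_eq_zero_iff, fibPrefix_length]

lemma T_succ (k n : ℕ) : IsZiminImage (k + 1) (fibPrefix n) ↔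
    ∃ j, 2 * j < n ∧ (∀ i, i < j → fibInf i = fibInf (i + (n - j))) ∧
      IsZiminImage k (fibPrefix j) := by
  rw [isZiminImage_succ]
  constructor
  · rintro ⟨u, x, hu, hx, hw⟩
    have hl := congrArg List.length hw
    rw [fibPrefix_length] at hl
    simp only [List.length_append] at hl
    have hx' := List.length_pos_iff.2 hx
    have key : ∀ i, i < u.length → u[i]? = some (fibInf i) := by
      intro i hi
      rw [← fibPrefix_getElem? (show i < n by omega), hw, List.getElem?_append_left hi]
    have hu' : u = fibPrefix u.length := by
      apply List.ext_getElem?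
      intro i
      by_cases hi : i < u.length
      · rw [key i hi, fibPrefix_getElem? hi]
      · rw [List.getElem?_eq_none (by omega),
          List.getElem?_eq_none (by rw [fibPrefix_length]; omega)]
    refine ⟨u.length, by omega, ?_, hu' ▸ hu⟩
    intro i hi
    have h1 := key i hi
    have h2 := fibPrefix_getElem? (show i + (n - u.length) < n by omega)
    rw [hw, List.getElem?_append_right (by omega), List.getElem?_append_right (by omega)] at h2
    rw [show i + (n - u.length) - u.length - x.length = i by omega, h1] at h2
    exact Option.some.inj h2
  · rintro ⟨j, hj, hb, hT⟩
    refine ⟨fibPrefix j, ((fibPrefix n).drop j).take (n - 2 * j), hT, ?_, ?_⟩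
    · rw [← List.length_pos_iff]
      simp [fibPrefix_length]; omega
    · apply List.ext_getElem?
      intro i
      have hl : (((fibPrefix n).drop j).take (n - 2 * j)).length = n - 2 * j := by
        simp [fibPrefix_length]; omega
      by_cases hi : i < n
      · rw [fibPrefix_getElem? hi]
        by_cases h1 : i < j
        · rw [List.getElem?_append_left (by rw [fibPrefix_length]; exact h1),
            fibPrefix_getElem? h1]
        · rw [List.getElem?_append_right (by rw [fibPrefix_length]; omega), fibPrefix_length]
          by_cases h2 : i - j < n - 2 * j
          · rw [List.getElem?_append_left (by rw [hl]; exact h2),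
              List.getElem?_take_of_lt h2, List.getElem?_drop,
              fibPrefix_getElem? (by omega)]
            congr 2; omega
          · rw [List.getElem?_append_right (by rw [hl]; omega), hl,
              fibPrefix_getElem? (by omega), hb (i - j - (n - 2 * j)) (by omega)]
            congr 2; omega
      · rw [List.getElem?_eq_none (by rw [fibPrefix_length]; omega),
          List.getElem?_eq_none (by simp only [List.length_append, hl, fibPrefix_length]; omega)]

lemma T_le (k n : ℕ) (h : IsZiminImage k (fibPrefix n)) : k ≤ n := by
  induction k generalizing n with
  | zero => omega
  | succ k ih =>
    obtain ⟨j, h1, _, h2⟩ := (T_succ k n).1 h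
    have := ih j h2
    omega

lemma le_zimin {k n : ℕ} (h : IsZiminImage k (fibPrefix n)) : k ≤ ziminType (fibPrefix n) :=
  le_csSup ⟨n, fun k hk => T_le k n hk⟩ h

lemma zimin_le {K n : ℕ} (h : ∀ k, IsZiminImage k (fibPrefix n) → k ≤ K) :
    ziminType (fibPrefix n) ≤ K :=
  csSup_le' (fun k hk => h k hk)

/-- Lower bound. -/
lemma lower (k n : ℕ) (h : Nat.fib (3 * k + 2) < 2 * n) :
    IsZiminImage (k + 1) (fibPrefix n) := by
  induction k generalizing n with
  | zero =>
    rw [T_succ]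
    simp at h
    exact ⟨0, by omega, by simp, (T_zero 0).2 rfl⟩
  | succ k ih =>
    have hex : ∃ d, n < 2 * Nat.fib (3 * k + 3 + d) := by
      refine ⟨n + 2, ?_⟩
      have h1 := lt_Phi n
      rw [Phi_eq] at h1
      have := Nat.fib_mono (show n + 2 + 2 ≤ 3 * k + 3 + (n + 2) by omega)
      omega
    classical
    obtain ⟨d, hd, hmin⟩ : ∃ d, n < 2 * Nat.fib (3 * k + 3 + d) ∧
        ∀ d' < d, ¬ n < 2 * Nat.fib (3 * k + 3 + d') :=
      ⟨Nat.find hex, Nat.find_spec hex, fun d' h => Nat.find_min hex h⟩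
    have hbig : Nat.fib (3 * k + 2) < 2 * (n - Nat.fib (3 * k + 3 + d)) ∧
        Nat.fib (3 * k + 3 + d) ≤ n := by
      have e1 := fib_rec (3 * k + 3)
      have e2 := fib_rec (3 * k + 2)
      have e0 : 3 * (k + 1) + 2 = 3 * k + 5 := by ring
      rw [e0] at h
      simp only [Nat.add_assoc, Nat.reduceAdd] at e1 e2 h ⊢
      match d with
      | 0 => simp only [Nat.add_zero]; omega
      | d + 1 =>
        have hm := hmin d (by omega)
        have f1 := fib_rec (3 * k + 2 + d)
        have f2 := fib_rec (3 * k + 1 + d)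
        have f3 := Nat.fib_mono (show 3 * k + 1 ≤ 3 * k + 1 + d by omega)
        have f4 := fib_rec (3 * k)
        have f5 : Nat.fib (3 * k) < Nat.fib (3 * k + 1) := by
          rcases Nat.eq_zero_or_pos k with rfl | hk
          · decide
          · exact Nat.fib_lt_fib_succ (by omega)
        have a1 : 3 * k + 3 + (d + 1) = 3 * k + 2 + d + 2 := by ring
        have a2 : 3 * k + 3 + d = 3 * k + 1 + d + 2 := by ring
        have a3 : 3 * k + 2 + d + 1 = 3 * k + 1 + d + 2 := by ring
        have a4 : 3 * k + 1 + d + 1 = 3 * k + 2 + d := by ring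
        rw [a2] at hm
        rw [a3] at f1
        rw [a4] at f2
        rw [show 3 * k + (3 + (d + 1)) = 3 * k + 2 + d + 2 by ring]
        omega
    obtain ⟨hb1, hb2⟩ := hbig
    rw [T_succ]
    refine ⟨n - Nat.fib (3 * k + 3 + d), by omega, ?_, ih _ hb1⟩
    intro i hi
    rw [show n - (n - Nat.fib (3 * k + 3 + d)) = Nat.fib (3 * k + 3 + d) by omega]
    have e := fib_rec (3 * k + 2 + d)
    have hp : 0 < Nat.fib (3 * k + 2 + d) := Nat.fib_pos.2 (by omega)
    have a4 : 3 * k + 2 + d + 1 = 3 * k + 3 + d := by ring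
    rw [a4] at e
    have := fibInf_per (3 * k + 1 + d) i (by
      rw [show 3 * k + 1 + d + 3 = 3 * k + 2 + d + 2 by ring]
      omega)
    rw [show 3 * k + 1 + d + 2 = 3 * k + 3 + d by ring] at this
    exact this.symm

def NN : ℕ → ℕ
  | 0 => 0
  | k + 1 => NN k + Nat.fib (3 * k + 3)

lemma NN_eq (k : ℕ) : 2 * NN k + 1 = Nat.fib (3 * k + 2) := by
  induction k with
  | zero => rfl
  | succ k ih =>
    have e1 := fib_rec (3 * k + 3)
    have e2 := fib_rec (3 * k + 2)
    have e0 : 3 * (k + 1) + 2 = 3 * k + 5 := by ring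
    rw [e0]
    simp only [Nat.add_assoc, Nat.reduceAdd] at e1 e2
    simp only [NN]
    omega

/-- `j` is the length of a border (possibly full) of the prefix of length `n`. -/
def Bd (j n : ℕ) : Prop := j ≤ n ∧ ∀ i, i < j → fibInf i = fibInf (i + (n - j))

lemma Bd_trans {i j n : ℕ} (h1 : Bd i j) (h2 : Bd j n) : Bd i n := by
  refine ⟨h1.1.trans h2.1, fun t ht => ?_⟩
  have a := h1.1
  have b := h2.1
  rw [h1.2 t ht, h2.2 (t + (j - i)) (by omega)]
  congr 1; omega

lemma Bd_of_le {i j n : ℕ} (h1 : Bd i n) (h2 : Bd j n) (h : i ≤ j) : Bd i j := by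
  refine ⟨h, fun t ht => ?_⟩
  have b := h2.1
  rw [h1.2 t ht, h2.2 (t + (j - i)) (by omega)]
  congr 1; omega

lemma Bd_NN (k : ℕ) : Bd (NN k) (NN (k + 1)) := by
  refine ⟨by simp [NN], fun i hi => ?_⟩
  rw [show NN (k + 1) - NN k = Nat.fib (3 * k + 3) by simp [NN]]
  have h := NN_eq k
  exact (fibInf_S (n := 3 * k) (by omega)).symm

lemma short_le (k j : ℕ) (hj : 2 * j < NN (k + 1)) (hb : Bd j (NN (k + 1))) : j ≤ NN k := by
  match k with
  | 0 => simp [NN, Nat.fib] at *; omega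
  | k + 1 =>
    by_contra hlt
    have h1 := NN_eq (k + 1)
    have h2 : NN (k + 1 + 1) = NN (k + 1) + Nat.fib (3 * k + 6) := rfl
    have e0 : 3 * (k + 1) + 2 = 3 * k + 5 := by ring
    rw [e0] at h1
    have e1 := fib_rec (3 * k + 4)
    have e2 := fib_rec (3 * k + 3)
    have e3 := fib_rec (3 * k + 2)
    have : 0 < Nat.fib (3 * k + 2) := Nat.fib_pos.2 (by omega)
    simp only [Nat.add_assoc, Nat.reduceAdd] at *
    obtain ⟨i, hi1, hi2⟩ := mismatch' (3 * k + 2) (NN (k + 2) - j)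
      (by change Nat.fib (3 * k + 5) < _; omega) (by change _ < Nat.fib (3 * k + 6); omega)
    change _ ≤ 2 * Nat.fib (3 * k + 5) at hi1
    exact hi2 (hb.2 i (by omega))

/-- Upper bound. -/
lemma upper (k j : ℕ) (hj : Bd j (NN k)) (K : ℕ) (hT : IsZiminImage K (fibPrefix j)) :
    K ≤ k := by
  induction k generalizing j K with
  | zero =>
    have := hj.1
    have := T_le K j hT
    simp [NN] at *; omega
  | succ k ih =>
    match K with
    | 0 => omega
    | K + 1 =>
      obtain ⟨i, h1, h2, h3⟩ := (T_succ K j).1 hT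
      have hi : Bd i (NN (k + 1)) := Bd_trans ⟨by omega, h2⟩ hj
      have := hj.1
      have hle := short_le k i (by omega) hi
      have := ih i (Bd_of_le hi (Bd_NN k) hle) K h3
      omega

lemma zimin_NN (k : ℕ) : ziminType (fibPrefix (NN k)) ≤ k :=
  zimin_le fun K h => upper k _ ⟨le_rfl, by simp⟩ K h

lemma T_fib (k : ℕ) : IsZiminImage (k + 1) (fibPrefix (Nat.fib (2 * k + 2))) := by
  induction k with
  | zero => exact lower 0 _ (by decide)
  | succ k ih =>
    rw [T_succ]
    have e := fib_rec (2 * k + 2)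
    have e2 := fib_rec (2 * k + 1)
    have : 0 < Nat.fib (2 * k + 1) := Nat.fib_pos.2 (by omega)
    simp only [Nat.add_assoc, Nat.reduceAdd] at e e2
    rw [show 2 * (k + 1) + 2 = 2 * k + 4 by ring]
    refine ⟨Nat.fib (2 * k + 2), by omega, ?_, ih⟩
    intro i hi
    rw [show Nat.fib (2 * k + 4) - Nat.fib (2 * k + 2) = Nat.fib (2 * k + 3) by omega]
    exact (fibInf_S hi).symm

lemma gsq : goldenR ^ 2 = goldenR + 1 := by
  have : Real.sqrt 5 ^ 2 = 5 := Real.sq_sqrt (by norm_num)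
  unfold goldenR
  nlinarith

lemma g_gt : (3 / 2 : ℝ) < goldenR := by
  have : (2 : ℝ) < Real.sqrt 5 := by
    rw [Real.lt_sqrt (by norm_num)]; norm_num
  unfold goldenR
  linarith

lemma fib_le_pow (n : ℕ) : (Nat.fib (n + 1) : ℝ) ≤ goldenR ^ n ∧
    (Nat.fib (n + 2) : ℝ) ≤ goldenR ^ (n + 1) := by
  induction n with
  | zero => have := g_gt; simp; linarith
  | succ n ih =>
    refine ⟨ih.2, ?_⟩
    have e := fib_rec (n + 1)
    rw [e]; push_cast
    have : goldenR ^ (n + 1 + 1) = goldenR ^ n + goldenR ^ (n + 1) := by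
      have := gsq
      calc goldenR ^ (n + 1 + 1) = goldenR ^ n * goldenR ^ 2 := by ring
        _ = _ := by rw [this]; ring
    rw [this]
    exact add_le_add ih.1 ih.2

lemma pow_le_fib (n : ℕ) : goldenR ^ n ≤ (Nat.fib (n + 2) : ℝ) ∧
    goldenR ^ (n + 1) ≤ (Nat.fib (n + 3) : ℝ) := by
  induction n with
  | zero =>
    have := gsq
    have := g_gt
    simp [Nat.fib]; nlinarith
  | succ n ih =>
    refine ⟨ih.2, ?_⟩
    have e := fib_rec (n + 2)
    rw [show n + 1 + 3 = n + 2 + 2 by ring, e]; push_cast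
    have : goldenR ^ (n + 1 + 1) = goldenR ^ n + goldenR ^ (n + 1) := by
      have := gsq
      calc goldenR ^ (n + 1 + 1) = goldenR ^ n * goldenR ^ 2 := by ring
        _ = _ := by rw [this]; ring
    rw [this]
    exact add_le_add ih.1 ih.2

noncomputable def LL (n : ℕ) : ℝ := Real.log n / Real.log goldenR

lemma logg_pos : 0 < Real.log goldenR := Real.log_pos (by have := g_gt; linarith)

lemma LL_le {n m : ℕ} (hn : 0 < n) (h : (n : ℝ) ≤ goldenR ^ m) : LL n ≤ m := by
  unfold LL
  rw [div_le_iff₀ logg_pos, ← Real.log_pow]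
  exact Real.log_le_log (by exact_mod_cast hn) h

lemma le_LL {n m : ℕ} (h : goldenR ^ m ≤ (n : ℝ)) : (m : ℝ) ≤ LL n := by
  unfold LL
  rw [le_div_iff₀ logg_pos, ← Real.log_pow]
  exact Real.log_le_log (pow_pos (by have := g_gt; linarith) _) h

lemma LL_tendsto : Tendsto LL atTop atTop :=
  (Real.tendsto_log_atTop.comp tendsto_natCast_atTop_atTop).atTop_div_const logg_pos

lemma aseq_eq (n : ℕ) : aseq n = (ziminType (fibPrefix n) : ℝ) / LL n := rfl

lemma zimin_ge (n : ℕ) (hn : 0 < n) : LL n ≤ 3 * ziminType (fibPrefix n) + 1 := by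
  have hex : ∃ k, 2 * n ≤ Nat.fib (3 * k + 2) := by
    refine ⟨2 * n, ?_⟩
    have h1 := lt_Phi (2 * n)
    rw [Phi_eq] at h1
    have := Nat.fib_mono (show 2 * n + 2 + 2 ≤ 3 * (2 * n) + 2 by omega)
    omega
  classical
  obtain ⟨k, hk, hmin⟩ : ∃ k, 2 * n ≤ Nat.fib (3 * k + 2) ∧
      ∀ d' < k, ¬ 2 * n ≤ Nat.fib (3 * d' + 2) :=
    ⟨Nat.find hex, Nat.find_spec hex, fun d' h => Nat.find_min hex h⟩
  match k with
  | 0 => simp at hk; omega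
  | k + 1 =>
    have h1 := le_zimin (lower k n (not_le.1 (hmin k (by omega))))
    have h2 : (n : ℝ) ≤ goldenR ^ (3 * (k + 1) + 1) := by
      refine le_trans ?_ (fib_le_pow _).1
      have hk' : 2 * n ≤ Nat.fib (3 * (k + 1) + 1 + 1) := hk
      exact_mod_cast (by omega : n ≤ Nat.fib (3 * (k + 1) + 1 + 1))
    have h3 := LL_le hn h2
    have h4 : ((k + 1 : ℕ) : ℝ) ≤ ziminType (fibPrefix n) := by exact_mod_cast h1
    push_cast at h3 h4
    linarith

lemma NN_big (k : ℕ) : goldenR ^ (3 * k) ≤ (NN (k + 1) : ℝ) := by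
  have h := NN_eq (k + 1)
  have h1 := (pow_le_fib (3 * (k + 1))).1
  rw [← h] at h1
  push_cast at h1
  have h3 : (3 : ℝ) ≤ goldenR ^ 3 := by
    have := gsq
    have := g_gt
    calc (3 : ℝ) ≤ goldenR * (goldenR + 1) := by nlinarith
      _ = goldenR ^ 3 := by rw [← gsq]; ring
  have h4 : (1 : ℝ) ≤ goldenR ^ (3 * k) := one_le_pow₀ (by have := g_gt; linarith)
  have h5 : goldenR ^ (3 * (k + 1)) = goldenR ^ (3 * k) * goldenR ^ 3 := by ring
  rw [h5] at h1
  nlinarith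

lemma aseq_NN (k : ℕ) (hk : 0 < k) : aseq (NN (k + 1)) ≤ 1 / 3 + 1 / (3 * k) := by
  have h1 := le_LL (NN_big k)
  have h2 : (ziminType (fibPrefix (NN (k + 1))) : ℝ) ≤ (k + 1 : ℕ) := by
    exact_mod_cast zimin_NN (k + 1)
  push_cast at h1 h2
  have hk' : (0 : ℝ) < k := by exact_mod_cast hk
  rw [aseq_eq]
  calc _ ≤ ((k : ℝ) + 1) / (3 * k) := by gcongr
    _ = _ := by field_simp

lemma le_NN (k : ℕ) : k ≤ NN k := by
  induction k with
  | zero => simp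
  | succ k ih =>
    have : 0 < Nat.fib (3 * k + 3) := Nat.fib_pos.2 (by omega)
    simp only [NN]; omega

lemma aseq_fib (k : ℕ) (hk : 0 < k) : 1 / 2 ≤ aseq (Nat.fib (2 * k + 2)) := by
  have h1 := le_zimin (T_fib k)
  have h1' : ((k + 1 : ℕ) : ℝ) ≤ ziminType (fibPrefix (Nat.fib (2 * k + 2))) := by
    exact_mod_cast h1
  have h2 := LL_le (Nat.fib_pos.2 (by omega)) (fib_le_pow (2 * k)).2
  have h3 : 0 < LL (Nat.fib (2 * k + 2)) := by
    have := le_LL (pow_le_fib (2 * k)).1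
    have hk' : (0 : ℝ) < k := by exact_mod_cast hk
    push_cast at this
    linarith
  rw [aseq_eq, le_div_iff₀ h3]
  push_cast at *
  linarith

lemma liminf_eq : Filter.liminf aseq Filter.atTop = 1 / 3 := by
  have hlow : ∀ ε > 0, ∀ᶠ n in atTop, 1 / 3 - ε ≤ aseq n := by
    intro ε hε
    filter_upwards [LL_tendsto.eventually_ge_atTop (1 / ε), eventually_gt_atTop 0] with n h1 h2
    have hL : 0 < LL n := lt_of_lt_of_le (by positivity) h1
    rw [aseq_eq, le_div_iff₀ hL]
    have h3 := zimin_ge n h2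
    have h4 : 1 ≤ LL n * ε := (div_le_iff₀ hε).1 h1
    nlinarith
  have hup : ∀ ε > 0, ∃ᶠ n in atTop, aseq n ≤ 1 / 3 + ε := by
    intro ε hε
    rw [frequently_atTop]
    intro a
    obtain ⟨m, hm⟩ := exists_nat_gt (1 / ε)
    have hm' : m ≤ a + m + 1 := by omega
    refine ⟨NN (a + m + 1 + 1), ?_, ?_⟩
    · have := le_NN (a + m + 1 + 1); omega
    · refine (aseq_NN (a + m + 1) (by omega)).trans ?_
      have h5 : 1 / ε < ((a + m + 1 : ℕ) : ℝ) := hm.trans_le (by exact_mod_cast hm')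
      have h6 : 0 < ((a + m + 1 : ℕ) : ℝ) := lt_trans (by positivity) h5
      have h7 : 1 / (3 * ((a + m + 1 : ℕ) : ℝ)) ≤ ε := by
        rw [div_le_iff₀ (by positivity)]
        rw [div_lt_iff₀ hε] at h5
        nlinarith
      linarith
  have hbdd : IsBoundedUnder (· ≥ ·) atTop aseq := ⟨1 / 3 - 1, hlow 1 one_pos⟩
  have hcob : IsCoboundedUnder (· ≥ ·) atTop aseq :=
    IsCoboundedUnder.of_frequently_le (hup 1 one_pos)
  apply le_antisymm
  · apply le_of_forall_pos_le_add
    intro ε hε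
    exact liminf_le_of_frequently_le (hup ε hε) hbdd
  · apply le_of_forall_pos_le_add
    intro ε hε
    have := le_liminf_of_le hcob (hlow ε hε)
    linarith

end helpers

/-- Corollary 1 (part): `liminf_{n→∞} ZFib[n] / log_φ n = 1/3`; in particular
the sequence `a_n` has no limit. -/
theorem liminf_aseq :
    Filter.liminf aseq Filter.atTop = 1 / 3 ∧
      ¬∃ l : ℝ, Filter.Tendsto aseq Filter.atTop (nhds l) := by
  refine ⟨liminf_eq, ?_⟩
  rintro ⟨l, hl⟩
  have h1 : l = 1 / 3 := hl.liminf_eq.symm.trans liminf_eq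
  have ht : Tendsto (fun k => Nat.fib (2 * k + 2)) atTop atTop := by
    apply tendsto_atTop_mono (f := fun k : ℕ => k) _ tendsto_id
    intro k
    have h1 := lt_Phi k
    rw [Phi_eq] at h1
    rcases k with _ | k
    · simp
    · have := Nat.fib_mono (show k + 1 + 2 + 2 ≤ 2 * (k + 1) + 2 + 1 by omega)
      rcases k with _ | k
      · decide
      · have := Nat.fib_mono (show k + 1 + 1 + 2 + 2 ≤ 2 * (k + 1 + 1) + 2 by omega)
        change k + 1 + 1 ≤ Nat.fib (2 * (k + 1 + 1) + 2)
        omega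
  have h2 : (1 / 2 : ℝ) ≤ l := by
    refine ge_of_tendsto (hl.comp ht) ?_
    filter_upwards [eventually_gt_atTop 0] with k hk
    exact aseq_fib k hk
  rw [h1] at h2
  norm_num at h2
end

section
/- Let w be a nonempty factor of the infinite Fibonacci word, let n be the last position of the leftmost occurrence of w in F_∞, and let k ≥ 1 be such that Φ_{2(k-1)} ≤ n < Φ_{2k}. Then the Zimin type of w is at most k, and k equals the Zimin type of the Fibonacci word F_{2(k-1)}. -/
open List Filter

/-- `w` occurs in the infinite Fibonacci word at (0-indexed) position `i`. -/
def fibOccursAt (w : List Bool) (i : ℕ) : Prop :=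
  w = (List.range w.length).map (fun j => fibInf (i + j))

/-- `w` is a factor of the infinite Fibonacci word. -/
def IsFibFactor (w : List Bool) : Prop := ∃ i, fibOccursAt w i

namespace ZF

lemma Phi_eq (n : ℕ) : Phi n = Nat.fib (n + 2) := by
  induction n using Nat.strong_induction_on with
  | _ n ih =>
    match n with
    | 0 => rfl
    | 1 => rfl
    | n + 2 =>
      have h0 := ih n (by omega)
      have h1 := ih (n + 1) (by omega)
      have : Phi (n + 2) = Phi (n + 1) + Phi n := by
        simp [Phi, fibWord]
      rw [this, h0, h1, Nat.fib_add_two (n := n + 2)]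
      ring

lemma prefix_succ (n : ℕ) : fibWord n <+: fibWord (n + 1) := by
  match n with
  | 0 => exact ⟨[true], rfl⟩
  | n + 1 => exact ⟨fibWord n, rfl⟩

lemma prefix_le {m n : ℕ} (h : m ≤ n) : fibWord m <+: fibWord n := by
  induction n, h using Nat.le_induction with
  | base => exact List.prefix_rfl
  | succ n _ ih => exact ih.trans (prefix_succ n)

lemma lt_len (n : ℕ) : n < (fibWord n).length := by
  have h : Phi n = _ := Phi_eq n
  unfold Phi at h
  rw [h]
  induction n with
  | zero => decide
  | succ n ih =>
    have h2 := ih (Phi_eq n)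
    have : 0 < Nat.fib (n + 1) := Nat.fib_pos.2 (by omega)
    have h3 : Nat.fib (n + 1 + 2) = Nat.fib (n + 1) + Nat.fib (n + 2) := Nat.fib_add_two
    omega

lemma prefix_getElem? {u v : List Bool} (h : u <+: v) {i : ℕ} (hi : i < u.length) :
    u[i]? = v[i]? := by
  obtain ⟨t, rfl⟩ := h
  rw [List.getElem?_append_left hi]

lemma get_fib (n i : ℕ) (hi : i < (fibWord n).length) : (fibWord n)[i]? = some (fibInf i) := by
  have hl : i < (fibWord (i + 2)).length := by have := lt_len (i + 2); omega
  have h2 : (fibWord (i + 2))[i]? = some (fibInf i) := by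
    unfold fibInf
    rw [List.getD_eq_getElem?_getD, List.getElem?_eq_getElem hl]; rfl
  rcases le_total n (i + 2) with h | h
  · rw [prefix_getElem? (prefix_le h) hi, h2]
  · rw [← prefix_getElem? (prefix_le h) hl, h2]

def mor (b : Bool) : List Bool := if b then [false] else [false, true]

lemma fib_mor (n : ℕ) : fibWord (n + 1) = (fibWord n).flatMap mor := by
  induction n using Nat.strong_induction_on with
  | _ n ih =>
    match n with
    | 0 => rfl
    | 1 => rfl
    | n + 2 =>
      have h0 := ih n (by omega)
      have h1 := ih (n + 1) (by omega)
      show fibWord (n + 2) ++ fibWord (n + 1) = (fibWord (n + 1) ++ fibWord n).flatMap mor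
      rw [List.flatMap_append, ← h0, ← h1]

def f : ℕ → ℕ
  | 0 => 0
  | x + 1 => f x + (if fibInf x then 1 else 2)

lemma take_succ_fib (n x : ℕ) (hx : x < (fibWord n).length) :
    (fibWord n).take (x + 1) = (fibWord n).take x ++ [fibInf x] := by
  rw [List.take_succ, get_fib n x hx]; rfl

lemma len_mor (n x : ℕ) (hx : x ≤ (fibWord n).length) :
    (((fibWord n).take x).flatMap mor).length = f x := by
  induction x with
  | zero => simp [f]
  | succ x ih =>
    rw [take_succ_fib n x (by omega), List.flatMap_append, List.length_append, ih (by omega), f]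
    cases fibInf x <;> simp [mor]

lemma pre_mor (n x : ℕ) (hx : x < (fibWord n).length) :
    ((fibWord n).take x).flatMap mor ++ mor (fibInf x) <+: fibWord (n + 1) := by
  rw [fib_mor]
  have h := List.take_append_drop (x + 1) (fibWord n)
  rw [take_succ_fib n x hx] at h
  refine ⟨((fibWord n).drop (x + 1)).flatMap mor, ?_⟩
  conv_rhs => rw [← h]
  simp

lemma F_block (x j : ℕ) (hj : j < (mor (fibInf x)).length) :
    (mor (fibInf x))[j]? = some (fibInf (f x + j)) := by
  have hx := lt_len x
  have hp := pre_mor x x hx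
  have hl := len_mor x x hx.le
  have hj2 : f x + j < (((fibWord x).take x).flatMap mor ++ mor (fibInf x)).length := by
    rw [List.length_append, hl]; omega
  have h1 := prefix_getElem? hp hj2
  rw [get_fib _ _ (lt_of_lt_of_le hj2 hp.length_le)] at h1
  rw [← h1, List.getElem?_append_right (by omega), hl]
  congr 1; omega

lemma F_f (x : ℕ) : fibInf (f x) = false := by
  have := F_block x 0 (by unfold mor; split <;> simp)
  cases h : fibInf x <;> simp [h, mor] at this <;> simp [this]

lemma F_f1 (x : ℕ) : fibInf (f x + 1) = !fibInf x := by
  cases h : fibInf x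
  · have := F_block x 1 (by simp [h, mor])
    simp [h, mor] at this
    simp [this]
  · have := F_f (x + 1)
    simpa [f, h] using this

lemma cover (i : ℕ) : ∃ x, i = f x ∨ (i = f x + 1 ∧ fibInf x = false) := by
  induction i with
  | zero => exact ⟨0, Or.inl rfl⟩
  | succ i ih =>
    obtain ⟨x, h | ⟨h, h2⟩⟩ := ih
    · cases hx : fibInf x
      · exact ⟨x, Or.inr ⟨by omega, hx⟩⟩
      · exact ⟨x + 1, Or.inl (by simp [f, hx, h])⟩
    · exact ⟨x + 1, Or.inl (by simp [f, h2, h])⟩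

lemma f_lt_succ (x : ℕ) : f x < f (x + 1) := by
  rw [f]; split <;> omega

lemma f_mono : StrictMono f := strictMono_nat_of_lt_succ f_lt_succ

/-- number of `a` in prefix -/
lemma f_sub (x : ℕ) : ∃ c, f x = x + c ∧ f c ≤ x + 1 ∧ x ≤ f c ∧ (f c = x + 1 → fibInf x = true) := by
  obtain ⟨c, h⟩ := cover x
  induction x generalizing c with
  | zero => exact ⟨0, by simp [f]⟩
  | succ x ih =>
    obtain ⟨c', h'⟩ := cover x
    obtain ⟨c, h1, h2, h3, h4⟩ := ih c' h'
    cases hx : fibInf x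
    · have e : f c = x := by
        rcases Nat.lt_or_ge x (f c) with hh | hh
        · have := h4 (by omega); simp [hx] at this
        · omega
      refine ⟨c + 1, by rw [f, hx, h1]; simp; ring, ?_, ?_, ?_⟩
      · rw [f]; split <;> omega
      · rw [f]; split <;> omega
      · intro hc
        have := F_f1 c
        rw [f] at hc
        cases hcc : fibInf c
        · rw [← e, this, hcc]; rfl
        · simp [hcc] at hc; omega
    · have e : f c ≠ x := by
        intro e; have := F_f c; rw [e, hx] at this; simp at this
      refine ⟨c, by rw [f, hx, h1]; simp; ring, by omega, by omega, by omega⟩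

lemma fib_rec (m : ℕ) : Nat.fib (m + 4) = Nat.fib (m + 3) + Nat.fib (m + 2) := by
  have h : Nat.fib (m + 4) = Nat.fib (m + 2) + Nat.fib (m + 3) := Nat.fib_add_two (n := m + 2)
  omega

lemma updown (m : ℕ) :
    (∀ x y, x ≤ y → y + 2 ≤ x + Nat.fib (m + 2) → f y + 3 ≤ f x + Nat.fib (m + 3)) ∧
    (∀ x y, x ≤ y → x + Nat.fib (m + 2) ≤ y + 1 → f x + Nat.fib (m + 3) ≤ f y + 2) := by
  induction m with
  | zero =>
    refine ⟨fun x y h1 h2 => ?_, fun x y h1 h2 => ?_⟩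
    · norm_num at h2; omega
    · have := f_mono.monotone h1
      show f x + 2 ≤ _
      omega
  | succ m ih =>
    obtain ⟨up, lo⟩ := ih
    have hr := fib_rec m
    have hpos : 0 < Nat.fib (m + 2) := Nat.fib_pos.2 (by omega)
    have hpos1 : 0 < Nat.fib (m + 1) := Nat.fib_pos.2 (by omega)
    have hr2 : Nat.fib (m + 3) = Nat.fib (m + 1) + Nat.fib (m + 2) := Nat.fib_add_two
    refine ⟨fun x y h1 h2 => ?_, fun x y h1 h2 => ?_⟩
    all_goals
      obtain ⟨c, hc1, hc2, hc3, hc4⟩ := f_sub x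
      obtain ⟨e, he1, he2, he3, he4⟩ := f_sub y
      rw [show m + 1 + 2 = m + 3 by ring] at h2
      rw [show m + 1 + 3 = m + 4 by ring]
    · by_contra hcon
      have hce : c + Nat.fib (m + 2) ≤ e := by omega
      obtain ⟨e', rfl⟩ : ∃ e', e = e' + 1 := ⟨e - 1, by omega⟩
      have h3 := lo c e' (by omega) (by omega)
      -- f e' < y
      have h4 : f e' < y := by
        have := f_lt_succ e'
        rcases Nat.lt_or_ge (f e') y with h | h
        · exact h
        · have h5 : f e' = y := by omega
          have h6 := he4 (by omega)
          rw [← h5, F_f] at h6; simp at h6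
      omega
    · by_contra hcon
      have hxe : c ≤ e := by
        by_contra h
        have := f_mono (show e < c by omega)
        have : f c = f e + 1 := by omega
        have h7 := hc4 (by omega)
        have : x = y := by omega
        subst this
        omega
      have h3 := up c e hxe (by omega)
      omega

lemma ff (x : ℕ) : f (f x) = f x + x := by
  induction x with
  | zero => rfl
  | succ x ih =>
    cases hx : fibInf x
    · have e : f (x + 1) = f x + 1 + 1 := by rw [f, hx]; rfl
      rw [e, f, f, F_f1, hx, F_f, ih]; simp; ring
    · have e : f (x + 1) = f x + 1 := by rw [f, hx]; rfl
      rw [e, f, F_f, ih]; simp; ring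

lemma desub (m : ℕ) : ∀ p d L, 0 < d → Nat.fib (m + 2) ≤ L + 1 →
    (∀ j < L, fibInf (p + j) = fibInf (p + d + j)) →
    ∃ q e, 0 < e ∧ f^[m] q + d = f^[m] (q + e) ∧
      f^[m + 1] q + f (p + d) = f^[m + 1] (q + e) + f p := by
  induction m with
  | zero => intro p d L hd _ _; exact ⟨p, d, hd, rfl, Nat.add_comm _ _⟩
  | succ m ih =>
    intro p d L hd hL h
    rw [show m + 1 + 2 = m + 3 by ring] at hL
    have hpos : 0 < Nat.fib (m + 2) := Nat.fib_pos.2 (by omega)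
    have hpos1 : 0 < Nat.fib (m + 1) := Nat.fib_pos.2 (by omega)
    have hr2 : Nat.fib (m + 3) = Nat.fib (m + 1) + Nat.fib (m + 2) := Nat.fib_add_two
    have h0 := h 0 (by omega)
    simp only [Nat.add_zero] at h0
    obtain ⟨x, z, hpx, hpx', hz, hff⟩ : ∃ x z, f x ≤ p ∧ p ≤ f x + 1 ∧ f x + d = f z ∧
        f (p + d) + f (f x) = f (f z) + f p := by
      obtain ⟨x, hx⟩ := cover p
      obtain ⟨z, hz⟩ := cover (p + d)
      refine ⟨x, z, by omega, by omega, ?_⟩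
      have b1 : f (f x + 1) = f (f x) + 2 := by rw [f, F_f]; rfl
      have b2 : f (f z + 1) = f (f z) + 2 := by rw [f, F_f]; rfl
      have a1 := F_f x
      have a2 := F_f z
      have a3 := F_f1 x
      have a4 := F_f1 z
      rcases hx with hx | ⟨hx, hx'⟩ <;> rcases hz with hz | ⟨hz, hz'⟩
      · refine ⟨by omega, ?_⟩
        rw [hz, hx]
      · rw [hz, hx, a1, a4, hz'] at h0; simp at h0
      · rw [hz, hx, a2, a3, hx'] at h0; simp at h0
      · refine ⟨by omega, ?_⟩
        rw [hz, hx]; omega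
    have hxz : x < z := f_mono.lt_iff_lt.1 (by omega)
    have key : ∀ j, j + 1 ≤ Nat.fib (m + 2) →
        f (x + j) + d = f (z + j) ∧ ∀ i < j, fibInf (x + i) = fibInf (z + i) := by
      intro j
      induction j with
      | zero => intro _; exact ⟨hz, by simp⟩
      | succ j ihj =>
        intro hj
        obtain ⟨i1, i2⟩ := ihj (by omega)
        have hu := (updown m).1 x (x + j) (by omega) (by omega)
        have hge := f_mono.monotone (show x ≤ x + j by omega)
        have hh := h (f (x + j) + 1 - p) (by omega)
        rw [show p + (f (x + j) + 1 - p) = f (x + j) + 1 by omega,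
          show p + d + (f (x + j) + 1 - p) = f (z + j) + 1 by omega, F_f1, F_f1] at hh
        have hh' : fibInf (x + j) = fibInf (z + j) := by
          simpa using hh
        refine ⟨?_, ?_⟩
        · rw [← Nat.add_assoc, ← Nat.add_assoc, f, f, hh']; omega
        · intro i hi
          rcases Nat.lt_succ_iff_lt_or_eq.1 hi with h | h
          · exact i2 i h
          · rw [h]; exact hh'
    obtain ⟨k1, k2⟩ := key (Nat.fib (m + 2) - 1) (by omega)
    obtain ⟨q, e, he, hq, hq'⟩ := ih x (z - x) (Nat.fib (m + 2) - 1) (by omega) (by omega) (by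
      intro j hj
      rw [k2 j hj]; congr 1; omega)
    rw [show x + (z - x) = z by omega] at hq'
    have t1 : ∀ y, f^[m + 1 + 1] y = f^[m + 1] y + f^[m] y := by
      intro y
      simp only [Function.iterate_succ_apply']
      exact ff _
    refine ⟨q, e, he, by omega, ?_⟩
    rw [t1, t1]
    have := ff x
    have := ff z
    omega

lemma iter_step (m : ℕ) : ∀ x, f^[m] (x + 1) =
    f^[m] x + if fibInf x then Nat.fib (m + 1) else Nat.fib (m + 2) := by
  induction m with
  | zero => intro x; simp
  | succ m ih =>
    intro x
    simp only [Function.iterate_succ_apply]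
    have hr2 : Nat.fib (m + 1 + 2) = Nat.fib (m + 1) + Nat.fib (m + 2) := Nat.fib_add_two
    cases hx : fibInf x
    · rw [f, hx]
      have h1 := ih (f x)
      have h2 := ih (f x + 1)
      rw [F_f] at h1
      rw [F_f1, hx] at h2
      simp at h1 h2 ⊢
      rw [h2, h1, hr2]; ring
    · rw [f, hx]
      have h1 := ih (f x)
      rw [F_f] at h1
      simpa using h1

lemma no_bb (x : ℕ) (h : fibInf x = true) : fibInf (x + 1) = false := by
  obtain ⟨y, hy | ⟨hy, hy'⟩⟩ := cover x
  · rw [hy, F_f] at h; simp at h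
  · have := F_f (y + 1)
    rw [f, hy'] at this
    rw [hy]; simpa using this

lemma gap (m p d L : ℕ) (hL : Nat.fib (m + 2) ≤ L) (hd : L < d)
    (h : ∀ j < L, fibInf (p + j) = fibInf (p + d + j)) : Nat.fib (m + 3) ≤ d := by
  obtain ⟨q, e, he, hq, -⟩ := desub m p d L (by omega) (by omega) h
  have hmon : Monotone (f^[m]) := f_mono.monotone.iterate m
  have h1 := iter_step m q
  have h2 := iter_step m (q + 1)
  have hr2 : Nat.fib (m + 3) = Nat.fib (m + 1) + Nat.fib (m + 2) := Nat.fib_add_two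
  have hle : Nat.fib (m + 1) ≤ Nat.fib (m + 2) := Nat.fib_mono (by omega)
  rcases Nat.lt_or_ge e 2 with h3 | h3
  · obtain rfl : e = 1 := by omega
    split at h1 <;> omega
  · have h4 := hmon (show q + 1 + 1 ≤ q + e by omega)
    have h5 := no_bb q
    cases a : fibInf q
    · rw [a] at h1
      simp at h1
      split at h2 <;> omega
    · rw [h5 a] at h2
      rw [a] at h1
      simp at h1 h2
      omega

lemma occ_iff (w : List Bool) (i : ℕ) :
    fibOccursAt w i ↔ ∀ j < w.length, w[j]? = some (fibInf (i + j)) := by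
  unfold fibOccursAt
  constructor
  · intro h j hj
    rw [h]; simp [hj]
  · intro h
    apply List.ext_getElem?
    intro j
    rcases Nat.lt_or_ge j w.length with hj | hj
    · rw [h j hj]; simp [hj]
    · rw [List.getElem?_eq_none hj, List.getElem?_eq_none (by simpa using hj)]

lemma zimin_len (k : ℕ) : ∀ (u : List Bool) (p : ℕ), IsZiminImage (k + 1) u → fibOccursAt u p →
    Nat.fib (2 * k + 2) ≤ u.length := by
  induction k with
  | zero =>
    rintro u p ⟨h, hh, rfl⟩ _
    simp [ziminWord]
    exact Nat.one_le_iff_ne_zero.2 (by simpa using hh 0)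
  | succ k ih =>
    rintro u p ⟨h, hh, hu⟩ ho
    rw [occ_iff] at ho
    have hu2 : u = (ziminWord (k + 1)).flatMap h ++ (h (k + 1) ++ (ziminWord (k + 1)).flatMap h) := by
      rw [hu, ziminWord]; simp
    set s := (ziminWord (k + 1)).flatMap h with hs
    have hv : 0 < (h (k + 1)).length := List.length_pos_iff.2 (hh _)
    set v := h (k + 1)
    have hlen : u.length = s.length + v.length + s.length := by rw [hu2]; simp; ring
    have o1 : ∀ j < s.length, s[j]? = some (fibInf (p + j)) := by
      intro j hj
      rw [← ho j (by omega), hu2, List.getElem?_append_left hj]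
    have o2 : ∀ j < s.length, s[j]? = some (fibInf (p + (s.length + v.length) + j)) := by
      intro j hj
      rw [Nat.add_assoc p, ← ho _ (by omega), hu2, List.getElem?_append_right (by omega),
        List.getElem?_append_right (by omega)]
      congr 1; omega
    have hl := ih s p ⟨h, hh, hs⟩ ((occ_iff _ _).2 o1)
    have hg := gap (2 * k) p (s.length + v.length) s.length hl (by omega) (by
      intro j hj
      have := (o1 j hj).symm.trans (o2 j hj)
      simpa using this)
    have hr : Nat.fib (2 * (k + 1) + 2) = Nat.fib (2 * k + 3) + Nat.fib (2 * k + 2) := fib_rec (2 * k)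
    omega

lemma type_bound (w : List Bool) (i k : ℕ) (ho : fibOccursAt w i) (h : w.length < Phi (2 * k)) :
    ∀ j ∈ {k | IsZiminImage k w}, j ≤ k := by
  intro j hj
  by_contra hc
  obtain ⟨l, rfl⟩ : ∃ l, j = l + 1 := ⟨j - 1, by omega⟩
  have h1 := zimin_len l w i hj ho
  rw [Phi_eq] at h
  have := Nat.fib_mono (show 2 * k + 2 ≤ 2 * l + 2 by omega)
  omega

def mh : ℕ → List Bool
  | 0 => [false]
  | 1 => [true]
  | i + 2 => fibWord (2 * i + 1)

lemma fib_image (k : ℕ) : fibWord (2 * k) = (ziminWord (k + 1)).flatMap mh := by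
  induction k with
  | zero => rfl
  | succ k ih =>
    rw [ziminWord, List.flatMap_append, List.flatMap_cons, ← ih]
    match k with
    | 0 => rfl
    | k + 1 =>
      show (fibWord (2 * k + 2) ++ fibWord (2 * k + 1)) ++ fibWord (2 * k + 2) = _
      rw [List.append_assoc]; rfl

lemma mh_ne (i : ℕ) : mh i ≠ [] := by
  match i with
  | 0 => simp [mh]
  | 1 => simp [mh]
  | i + 2 =>
    have := lt_len (2 * i + 1)
    intro h
    rw [mh] at h
    rw [h] at this; simp at this

end ZF

/-- Theorem 4: if `w` is a nonempty Fibonacci factor, `n` is the last position of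
the leftmost occurrence of `w` in `F_∞` (1-indexed, so `n = i + |w|` for the
0-indexed leftmost starting position `i`), and `Φ_{2(k-1)} ≤ n < Φ_{2k}`, then
`Ztype(w) ≤ k = Ztype(F_{2(k-1)})`. -/
theorem ziminType_fibFactor_le (w : List Bool) (hw : w ≠ []) (i n k : ℕ)
    (hocc : fibOccursAt w i) (hleft : ∀ i', fibOccursAt w i' → i ≤ i')
    (hn : n = i + w.length) (hk : 1 ≤ k)
    (h1 : Phi (2 * (k - 1)) ≤ n) (h2 : n < Phi (2 * k)) :
    ziminType w ≤ k ∧ k = ziminType (fibWord (2 * (k - 1))) := by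
  have hlt : Phi (2 * (k - 1)) < Phi (2 * k) := by omega
  have hof : fibOccursAt (fibWord (2 * (k - 1))) 0 := by
    rw [ZF.occ_iff]
    intro j hj
    rw [ZF.get_fib _ _ hj, Nat.zero_add]
  have hb := ZF.type_bound _ 0 k hof hlt
  refine ⟨csSup_le' (ZF.type_bound w i k hocc (by omega)), le_antisymm ?_ (csSup_le' hb)⟩
  refine le_csSup ⟨k, hb⟩ ⟨ZF.mh, ZF.mh_ne, ?_⟩
  rw [ZF.fib_image, Nat.sub_add_cancel hk]
end
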